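/- Let s, t ≥ 2 be integers and set n = st. With the data (t₁,t₂,t₃,t₄) = (1,1,t,t) and modulus n, for every integer r with 0 < r < n one has ψ₁(r) − 2·ψ₂(r)·r + 3·ψ₃(r)·r² − 4·ψ₄(r)·r³ = 0; that is, the coefficient φ₁ of the counting quasi-polynomial vanishes identically. -/

import Mathlib

open Finset

/-- `gJ n t J = gcd({t_j : j ∈ J} ∪ {n})`, so `gJ n t ∅ = n`. -/
def gJ {d : ℕ} (n : ℕ) (t : Fin d → ℕ) (J : Finset (Fin d)) : ℕ :=
  Nat.gcd (J.gcd t) n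

/-- `theta n t α J r` is the number of tuples `(a_ℓ)_{ℓ ∉ J}` of integers with
`0 ≤ a_ℓ ≤ r − 1` and `∑_{ℓ ∉ J} t_ℓ a_ℓ ≡ α (mod gJ n t J)`. -/
def theta {d : ℕ} (n : ℕ) (t : Fin d → ℕ) (α : ℤ) (J : Finset (Fin d)) (r : ℕ) : ℕ :=
  ((Fintype.piFinset fun _ : {ℓ : Fin d // ℓ ∉ J} => Finset.range r).filter
    fun a => (gJ n t J : ℤ) ∣ (∑ ℓ : {ℓ : Fin d // ℓ ∉ J}, (t ℓ.1 : ℤ) * a ℓ) - α).card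

/-- `psi n t α i r = ∑_{J ⊆ {1,…,d}, |J| = i} gJ · θ_J^{(α)}(r)`. -/
def psi {d : ℕ} (n : ℕ) (t : Fin d → ℕ) (α : ℤ) (i : ℕ) (r : ℕ) : ℕ :=
  ∑ J ∈ Finset.univ.filter (fun J : Finset (Fin d) => J.card = i),
    gJ n t J * theta n t α J r

theorem not_mem_of_not_mem_insert {d : ℕ} {J : Finset (Fin d)} {j ℓ : Fin d}
    (h : ℓ ∉ insert j J) : ℓ ∉ J :=
  fun h' => h (Finset.mem_insert_of_mem h')

theorem sum_compl_eq_add_sum_compl_insert {d : ℕ} {J : Finset (Fin d)} {j : Fin d} (hj : j ∉ J)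
    (f : {ℓ : Fin d // ℓ ∉ J} → ℤ) :
    ∑ ℓ, f ℓ = f ⟨j, hj⟩ +
      ∑ ℓ : {ℓ : Fin d // ℓ ∉ insert j J}, f ⟨ℓ.1, not_mem_of_not_mem_insert ℓ.2⟩ := by
  let e : Option {ℓ : Fin d // ℓ ∉ insert j J} → {ℓ : Fin d // ℓ ∉ J} := fun o =>
    o.elim ⟨j, hj⟩ fun ℓ => ⟨ℓ.1, not_mem_of_not_mem_insert ℓ.2⟩
  have he : Function.Bijective e := by
    constructor
    · rintro (_ | ⟨a, ha⟩) (_ | ⟨b, hb⟩) h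
      · rfl
      · exact absurd (Finset.mem_insert.mpr (.inl (congrArg Subtype.val h).symm)) hb
      · exact absurd (Finset.mem_insert.mpr (.inl (congrArg Subtype.val h))) ha
      · simpa [e] using h
    · rintro ⟨ℓ, hℓ⟩
      by_cases h : ℓ = j
      · exact ⟨none, by simp [e, h]⟩
      · exact ⟨some ⟨ℓ, by simp [h, hℓ]⟩, rfl⟩
  rw [← he.sum_comp f, Fintype.sum_option]
  rfl

/-- A coordinate whose weight vanishes modulo `gJ n t J` can be chosen freely. -/
theorem theta_eq_mul_theta_insert {d : ℕ} (n : ℕ) (t : Fin d → ℕ) (α : ℤ) {J : Finset (Fin d)}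
    {j : Fin d} (hj : j ∉ J) (hg : gJ n t (insert j J) = gJ n t J) (r : ℕ) :
    theta n t α J r = r * theta n t α (insert j J) r := by
  have hdvd : (gJ n t J : ℤ) ∣ (t j : ℤ) := by
    rw [← hg]
    exact_mod_cast (Nat.gcd_dvd_left _ _).trans (Finset.gcd_dvd (Finset.mem_insert_self j J))
  have key (a : {ℓ : Fin d // ℓ ∉ J} → ℕ) :
      (gJ n t J : ℤ) ∣ (∑ ℓ : {ℓ : Fin d // ℓ ∉ J}, (t ℓ.1 : ℤ) * a ℓ) - α ↔
        (gJ n t (insert j J) : ℤ) ∣ (∑ ℓ : {ℓ : Fin d // ℓ ∉ insert j J},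
          (t ℓ.1 : ℤ) * a ⟨ℓ.1, not_mem_of_not_mem_insert ℓ.2⟩) - α := by
    rw [sum_compl_eq_add_sum_compl_insert hj, hg, add_sub_assoc]
    exact dvd_add_right (hdvd.mul_right _)
  have hne (ℓ : {ℓ : Fin d // ℓ ∉ insert j J}) : ℓ.1 ≠ j := fun h =>
    ℓ.2 (Finset.mem_insert.mpr (.inl h))
  conv_rhs => rw [← Finset.card_range r]
  unfold theta
  rw [← Finset.card_product]
  refine Finset.card_nbij'
    (fun a => (a ⟨j, hj⟩, fun ℓ => a ⟨ℓ.1, not_mem_of_not_mem_insert ℓ.2⟩))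
    (fun p ℓ => if h : ℓ.1 = j then p.1 else p.2 ⟨ℓ.1, by simp [h, ℓ.2]⟩) ?_ ?_ ?_ ?_
  · intro a ha
    simp only [Finset.coe_filter, Set.mem_ofPred_eq, Fintype.mem_piFinset, key] at ha
    simp only [Finset.mem_coe, Finset.mem_product, Finset.mem_filter, Fintype.mem_piFinset,
      Finset.card_range]
    exact ⟨ha.1 _, fun ℓ => ha.1 _, ha.2⟩
  · rintro ⟨x, b⟩ hb
    simp only [Finset.mem_coe, Finset.mem_product, Finset.mem_filter, Fintype.mem_piFinset,
      Finset.card_range] at hb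
    simp only [Finset.coe_filter, Set.mem_ofPred_eq, Fintype.mem_piFinset, key]
    refine ⟨fun ℓ => ?_, ?_⟩
    · split_ifs
      · exact hb.1
      · exact hb.2.1 _
    · simpa [hne] using hb.2.2
  · intro a _
    funext ℓ
    by_cases h : ℓ.1 = j
    · subst h
      simp
    · simp [h]
  · rintro ⟨x, b⟩ _
    simp [hne]

theorem theta_of_gJ_eq_one {d : ℕ} (n : ℕ) (t : Fin d → ℕ) (α : ℤ) {J : Finset (Fin d)}
    (hg : gJ n t J = 1) (r : ℕ) : theta n t α J r = r ^ (d - J.card) := by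
  unfold theta
  rw [hg, Finset.filter_true_of_mem (by simp)]
  simp [Fintype.card_piFinset]

/-- Example 4.11 of the paper: for the cyclic quotient singularity
`1/n(1,1,t,t)` with `n = st`, `s,t ≥ 2`, the coefficient
`φ₁ = (1/n)(ψ₁ − 2ψ₂r + 3ψ₃r² − 4ψ₄r³)` of `p^e` in the F-signature function
vanishes identically, i.e. `ψ₁(r) − 2ψ₂(r)r + 3ψ₃(r)r² − 4ψ₄(r)r³ = 0` for
every `0 < r < n`. -/
theorem stmt17 (s t : ℕ) (hs : 2 ≤ s) (ht : 2 ≤ t) (r : ℕ)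
    (hr0 : 0 < r) (hrn : r < s * t) :
    (psi (s * t) ![1, 1, t, t] 0 1 r : ℤ)
        - 2 * (psi (s * t) ![1, 1, t, t] 0 2 r : ℤ) * (r : ℤ)
        + 3 * (psi (s * t) ![1, 1, t, t] 0 3 r : ℤ) * (r : ℤ) ^ 2
        - 4 * (psi (s * t) ![1, 1, t, t] 0 4 r : ℤ) * (r : ℤ) ^ 3 = 0 := by
  have g1 (J : Finset (Fin 4)) (hJ : 0 ∈ J ∨ 1 ∈ J) : gJ (s * t) ![1, 1, t, t] J = 1 := by
    have h : J.gcd ![1, 1, t, t] ∣ 1 := by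
      rcases hJ with h | h
      · simpa using Finset.gcd_dvd (f := ![1, 1, t, t]) h
      · simpa using Finset.gcd_dvd (f := ![1, 1, t, t]) h
    rw [gJ, Nat.dvd_one.mp h, Nat.gcd_one_left]
  have g2 : gJ (s * t) ![1, 1, t, t] {2} = t := by simp [gJ]
  have g3 : gJ (s * t) ![1, 1, t, t] {3} = t := by simp [gJ]
  have g23 : gJ (s * t) ![1, 1, t, t] {2, 3} = t := by simp [gJ]
  have θ1 (J : Finset (Fin 4)) (hJ : 0 ∈ J ∨ 1 ∈ J) :
      theta (s * t) ![1, 1, t, t] 0 J r = r ^ (4 - J.card) :=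
    theta_of_gJ_eq_one _ _ _ (g1 J hJ) r
  have θ2 : theta (s * t) ![1, 1, t, t] 0 {2} r =
      r * theta (s * t) ![1, 1, t, t] 0 {2, 3} r := by
    rw [theta_eq_mul_theta_insert (j := 3) _ _ _ (by decide)
      (by rw [g2, Finset.pair_comm, g23]), Finset.pair_comm]
  have θ3 : theta (s * t) ![1, 1, t, t] 0 {3} r =
      r * theta (s * t) ![1, 1, t, t] 0 {2, 3} r :=
    theta_eq_mul_theta_insert (j := 2) _ _ _ (by decide) (by rw [g3, g23]) r
  have p1 : (Finset.univ.filter fun J : Finset (Fin 4) => J.card = 1) =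
      {{0}, {1}, {2}, {3}} := by decide
  have p2 : (Finset.univ.filter fun J : Finset (Fin 4) => J.card = 2) =
      {{0, 1}, {0, 2}, {0, 3}, {1, 2}, {1, 3}, {2, 3}} := by decide
  have p3 : (Finset.univ.filter fun J : Finset (Fin 4) => J.card = 3) =
      {{0, 1, 2}, {0, 1, 3}, {0, 2, 3}, {1, 2, 3}} := by decide
  have p4 : (Finset.univ.filter fun J : Finset (Fin 4) => J.card = 4) =
      {{0, 1, 2, 3}} := by decide
  have ψ1 : psi (s * t) ![1, 1, t, t] 0 1 r =
      2 * r ^ 3 + 2 * t * r * theta (s * t) ![1, 1, t, t] 0 {2, 3} r := by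
    rw [psi, p1, Finset.sum_insert (by decide), Finset.sum_insert (by decide),
      Finset.sum_insert (by decide), Finset.sum_singleton, g2, g3, θ2, θ3,
      g1 _ (by decide), g1 _ (by decide), θ1 _ (by decide), θ1 _ (by decide)]
    simp only [Finset.card_singleton]
    ring
  have ψ2 : psi (s * t) ![1, 1, t, t] 0 2 r =
      5 * r ^ 2 + t * theta (s * t) ![1, 1, t, t] 0 {2, 3} r := by
    have h (J : Finset (Fin 4)) (hJ : (0 ∈ J ∨ 1 ∈ J) ∧ J.card = 2) :
        gJ (s * t) ![1, 1, t, t] J * theta (s * t) ![1, 1, t, t] 0 J r = r ^ 2 := by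
      rw [g1 J hJ.1, θ1 J hJ.1, hJ.2, one_mul]
    rw [psi, p2, Finset.sum_insert (by decide), Finset.sum_insert (by decide),
      Finset.sum_insert (by decide), Finset.sum_insert (by decide),
      Finset.sum_insert (by decide), Finset.sum_singleton, g23, h _ (by decide),
      h _ (by decide), h _ (by decide), h _ (by decide), h _ (by decide)]
    ring
  have ψ3 : psi (s * t) ![1, 1, t, t] 0 3 r = 4 * r := by
    have h (J : Finset (Fin 4)) (hJ : (0 ∈ J ∨ 1 ∈ J) ∧ J.card = 3) :
        gJ (s * t) ![1, 1, t, t] J * theta (s * t) ![1, 1, t, t] 0 J r = r := by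
      rw [g1 J hJ.1, θ1 J hJ.1, hJ.2, one_mul, pow_one]
    rw [psi, p3, Finset.sum_insert (by decide), Finset.sum_insert (by decide),
      Finset.sum_insert (by decide), Finset.sum_singleton, h _ (by decide),
      h _ (by decide), h _ (by decide), h _ (by decide)]
    ring
  have ψ4 : psi (s * t) ![1, 1, t, t] 0 4 r = 1 := by
    rw [psi, p4, Finset.sum_singleton, g1 _ (by decide), θ1 _ (by decide)]
    rfl
  rw [ψ1, ψ2, ψ3, ψ4]
  push_cast
  ring
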